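/- arXiv:2006.10382 — 2 statements merged into one kernel-verified Lean document; each statement's English description precedes it below -/
import Mathlib

section
/- If 𝒮 is a family of 6-dimensional linear subspaces of F₂^19 such that for all distinct U, W ∈ 𝒮 the subspace distance dim(U) + dim(W) − 2·dim(U ⊓ W) is at least 10, then the cardinality of 𝒮 is at most 70329353. Equivalently, A₂(19, 10; 6) ≤ 70329353. -/
set_option linter.unusedSectionVars false
namespace CDC
open Finset

def sgn (a : ZMod 2) : ℤ := if a = 0 then 1 else -1

lemma sgn_add (a b : ZMod 2) : sgn (a + b) = sgn a * sgn b := by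
  revert a b; decide

def wt {ι : Type*} [Fintype ι] (c : ι → ZMod 2) : ℕ := (univ.filter (fun i => c i ≠ 0)).card

def xs {ι : Type*} [Fintype ι] (c : ι → ZMod 2) : ℤ := ∑ i, sgn (c i)

lemma wt_eq_sum {ι : Type*} [Fintype ι] (c : ι → ZMod 2) :
    (wt c : ℤ) = ∑ i, (if c i = 0 then (0:ℤ) else 1) := by
  unfold wt
  rw [Finset.card_filter]
  push_cast
  apply Finset.sum_congr rfl
  intro i _
  by_cases h : c i = 0 <;> simp [h]

lemma xs_eq {ι : Type*} [Fintype ι] (c : ι → ZMod 2) :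
    xs c = Fintype.card ι - 2 * wt c := by
  rw [wt_eq_sum, xs, Finset.mul_sum, Fintype.card, Finset.card_eq_sum_ones]
  push_cast
  rw [← Finset.sum_sub_distrib]
  apply Finset.sum_congr rfl
  intro i _
  unfold sgn
  split_ifs <;> norm_num

lemma wt_zero {ι : Type*} [Fintype ι] {c : ι → ZMod 2} : wt c = 0 ↔ c = 0 := by
  unfold wt
  rw [Finset.card_eq_zero, Finset.filter_eq_empty_iff]
  constructor
  · intro h; funext i; simpa using h (Finset.mem_univ i)
  · intro h; simp [h]

lemma wt_le {ι : Type*} [Fintype ι] (c : ι → ZMod 2) : wt c ≤ Fintype.card ι := by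
  unfold wt; exact Finset.card_le_univ _

section char
variable {G : Type*} [AddCommGroup G] [Fintype G]

lemma char_zero (f : G →+ ZMod 2) (h : ∃ g, f g ≠ 0) : ∑ g, sgn (f g) = 0 := by
  obtain ⟨g0, h0⟩ := h
  have h1 : f g0 = 1 := by
    revert h0; generalize f g0 = a; revert a; decide
  have : ∑ g, sgn (f g) = ∑ g, sgn (f (g + g0)) :=
    (Equiv.sum_comp (Equiv.addRight g0) (fun g => sgn (f g))).symm
  have h2 : ∑ g, sgn (f (g + g0)) = - ∑ g, sgn (f g) := by
    rw [← Finset.sum_neg_distrib]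
    apply Finset.sum_congr rfl
    intro g _
    rw [map_add, sgn_add, h1]
    simp [sgn]
  linarith

lemma char_nonneg (f : G →+ ZMod 2) : 0 ≤ ∑ g, sgn (f g) := by
  by_cases h : ∃ g, f g ≠ 0
  · rw [char_zero f h]
  · push Not at h
    apply Finset.sum_nonneg
    intro g _
    rw [h g]; simp [sgn]

variable {ι : Type*} [Fintype ι]

def ev (e : G →+ (ι → ZMod 2)) (i : ι) : G →+ ZMod 2 := (Pi.evalAddMonoidHom _ i).comp e

def Full (e : G →+ (ι → ZMod 2)) : Prop := ∀ i, ∃ g, e g i ≠ 0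
def Sep (e : G →+ (ι → ZMod 2)) : Prop := ∀ i j, i ≠ j → ∃ g, e g i ≠ e g j
def Dv (Δ : ℕ) (e : G →+ (ι → ZMod 2)) : Prop := ∀ g, Δ ∣ wt (e g)

lemma pos (G : Type*) [AddCommGroup G] [Fintype G] : (0:ℤ) < Fintype.card G := by
  exact_mod_cast Fintype.card_pos

lemma coord (e : G →+ (ι → ZMod 2)) (hf : Full e) (i : ι) : ∑ g, sgn (e g i) = 0 :=
  char_zero (ev e i) (hf i)

lemma coord2 (e : G →+ (ι → ZMod 2)) (hs : Sep e) [DecidableEq ι] (i j : ι) :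
    ∑ g, sgn (e g i) * sgn (e g j) = if i = j then (Fintype.card G : ℤ) else 0 := by
  split_ifs with h
  · subst h
    have : ∀ g, sgn (e g i) * sgn (e g i) = 1 := by
      intro g; unfold sgn; split_ifs <;> norm_num
    simp [this]
  · obtain ⟨g, hg⟩ := hs i j h
    have := char_zero (ev e i + ev e j) ⟨g, by
      simp only [ev, AddMonoidHom.add_apply, AddMonoidHom.comp_apply, Pi.evalAddMonoidHom_apply]
      revert hg; generalize e g i = a; generalize e g j = b; revert a b; decide⟩
    rw [← this]
    apply Finset.sum_congr rfl
    intro g _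
    rw [← sgn_add]; rfl

lemma m1 (e : G →+ (ι → ZMod 2)) (hf : Full e) : ∑ g, xs (e g) = 0 := by
  unfold xs
  rw [Finset.sum_comm]
  apply Finset.sum_eq_zero
  intro i _
  exact coord e hf i

lemma m1P (e : G →+ (ι → ZMod 2)) (hs : Sep e) (i : ι) :
    ∑ g, xs (e g) * sgn (e g i) = Fintype.card G := by
  classical
  unfold xs
  simp only [Finset.sum_mul]
  rw [Finset.sum_comm]
  simp [coord2 e hs]

lemma m2 (e : G →+ (ι → ZMod 2)) (hs : Sep e) :
    ∑ g, xs (e g) ^ 2 = Fintype.card ι * Fintype.card G := by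
  classical
  have : ∀ g, xs (e g) ^ 2 = ∑ i, xs (e g) * sgn (e g i) := by
    intro g; rw [← Finset.mul_sum, sq]; rfl
  simp only [this]
  rw [Finset.sum_comm]
  simp [m1P e hs]

lemma m3 (e : G →+ (ι → ZMod 2)) : 0 ≤ ∑ g, xs (e g) ^ 3 := by
  have : ∀ g, xs (e g) ^ 3 = ∑ i, ∑ j, ∑ k, sgn ((ev e i + ev e j + ev e k) g) := by
    intro g
    have h : ∀ i j k, sgn ((ev e i + ev e j + ev e k) g)
        = sgn (e g i) * sgn (e g j) * sgn (e g k) := by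
      intro i j k; rw [← sgn_add, ← sgn_add]; rfl
    simp only [h, ← Finset.mul_sum, ← Finset.sum_mul]
    rw [pow_three, ← mul_assoc]; rfl
  simp only [this]
  rw [Finset.sum_comm]
  apply Finset.sum_nonneg; intro i _
  rw [Finset.sum_comm]
  apply Finset.sum_nonneg; intro j _
  rw [Finset.sum_comm]
  apply Finset.sum_nonneg; intro k _
  exact char_nonneg _

/-- restriction of the code to the zero set of the word `c`. -/
def res (e : G →+ (ι → ZMod 2)) (c : ι → ZMod 2) : G →+ ({i // c i = 0} → ZMod 2) where
  toFun g := fun i => e g i.1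
  map_zero' := by funext i; simp
  map_add' := by intro a b; funext i; simp

lemma res_full (e : G →+ (ι → ZMod 2)) (c : ι → ZMod 2) (h : Full e) : Full (res e c) :=
  fun i => h i.1
lemma res_sep (e : G →+ (ι → ZMod 2)) (c : ι → ZMod 2) (h : Sep e) : Sep (res e c) :=
  fun i j hij => h i.1 j.1 (fun h' => hij (Subtype.ext h'))

lemma res_card (c : ι → ZMod 2) : Fintype.card {i // c i = 0} + wt c = Fintype.card ι := by
  rw [Fintype.card_subtype, wt]
  exact Finset.card_filter_add_card_filter_not _

lemma res_wt (e : G →+ (ι → ZMod 2)) (a g : G) :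
    2 * (wt (res e (e a) g) : ℤ) = wt (e g) + wt (e (a + g)) - wt (e a) := by
  rw [wt_eq_sum, wt_eq_sum, wt_eq_sum, wt_eq_sum, Finset.mul_sum, ← Finset.sum_add_distrib,
    ← Finset.sum_sub_distrib]
  have : ∑ i : {i // e a i = 0}, 2 * (if res e (e a) g i = 0 then (0:ℤ) else 1)
      = ∑ i ∈ univ.filter (fun i => e a i = 0), 2 * (if e g i = 0 then (0:ℤ) else 1) := by
    rw [← Finset.sum_subtype_eq_sum_filter]
    apply Finset.sum_congr
    · ext; simp
    · intro i _; rfl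
  rw [this, Finset.sum_filter]
  apply Finset.sum_congr rfl
  intro i _
  rw [map_add, Pi.add_apply]
  generalize e a i = x; generalize e g i = y
  revert x y; decide

lemma res_dv (e : G →+ (ι → ZMod 2)) (a : G) (Δ : ℕ) (h : Dv (2 * Δ) e) : Dv Δ (res e (e a)) := by
  intro g
  have h1 := res_wt e a g
  obtain ⟨p, hp⟩ := h g
  obtain ⟨q, hq⟩ := h (a + g)
  obtain ⟨r, hr⟩ := h a
  rw [hp, hq, hr] at h1
  have : (wt (res e (e a) g) : ℤ) = Δ * (p + q - r) := by push_cast at h1; linarith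
  exact Int.natCast_dvd_natCast.mp ⟨_, this⟩

/-- length bound -/
lemma len_bound (e : G →+ (ι → ZMod 2)) (hf : Full e) (hs : Sep e) (Δ t : ℕ) (hd : Dv Δ e)
    (hn : Fintype.card ι = 3 + 2 * Δ * t) : 6 * (Δ : ℤ) ≤ Fintype.card ι + 9 := by
  have key : ∑ g, (xs (e g) - 3) * (xs (e g) - 3 + 2 * Δ) =
      Fintype.card G * ((Fintype.card ι : ℤ) + 9 - 6 * Δ) := by
    have : ∀ g, (xs (e g) - 3) * (xs (e g) - 3 + 2 * Δ)
      = xs (e g) ^ 2 + (2 * Δ - 6) * xs (e g) + (9 - 6 * Δ) := by intro g; ring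
    simp only [this, Finset.sum_add_distrib, ← Finset.mul_sum, m1 e hf, m2 e hs]
    simp
    ring
  have h0 : 0 ≤ ∑ g, (xs (e g) - 3) * (xs (e g) - 3 + 2 * Δ) := by
    apply Finset.sum_nonneg
    intro g _
    obtain ⟨p, hp⟩ := hd g
    rw [xs_eq, hn, hp]
    push_cast
    have : ((3:ℤ) + 2 * Δ * t - 2 * (Δ * p) - 3) * (3 + 2 * Δ * t - 2 * (Δ * p) - 3 + 2 * Δ)
      = (2 * Δ) ^ 2 * (((t:ℤ) - p) * (t - p + 1)) := by ring
    rw [this]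
    apply mul_nonneg (sq_nonneg _)
    rcases le_or_gt (0:ℤ) (t - p) with h | h
    · exact mul_nonneg h (by linarith)
    · exact mul_nonneg_of_nonpos_of_nonpos h.le (by linarith)
  rw [key] at h0
  have := nonneg_of_mul_nonneg_right h0 (pos G)
  linarith

end char
end CDC
set_option linter.unusedSectionVars false
namespace CDC
open Finset
section code
variable {G : Type*} [AddCommGroup G] [Fintype G]
variable {ι : Type*} [Fintype ι]

def cnt (e : G →+ (ι → ZMod 2)) (w : ℕ) : ℤ := ∑ g, if wt (e g) = w then (1:ℤ) else 0

lemma cnt_nonneg (e : G →+ (ι → ZMod 2)) (w : ℕ) : 0 ≤ cnt e w :=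
  Finset.sum_nonneg (fun g _ => by split_ifs <;> norm_num)

lemma cnt_card (e : G →+ (ι → ZMod 2)) (w : ℕ) :
    cnt e w = ((univ.filter (fun g => wt (e g) = w)).card : ℤ) := by
  rw [Finset.card_filter]; push_cast; rfl

lemma cnt_eq_zero (e : G →+ (ι → ZMod 2)) (w : ℕ) (h : cnt e w ≤ 0) (g : G) : wt (e g) ≠ w := by
  rw [cnt_card] at h
  have : (univ.filter (fun g => wt (e g) = w)).card = 0 := by
    have : (0:ℤ) ≤ ((univ.filter (fun g => wt (e g) = w)).card : ℤ) := by positivity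
    omega
  rw [Finset.card_eq_zero, Finset.filter_eq_empty_iff] at this
  exact this (Finset.mem_univ g)

lemma cnt_zero (e : G →+ (ι → ZMod 2)) (hi : Function.Injective e) : cnt e 0 = 1 := by
  classical
  rw [cnt_card]
  have : univ.filter (fun g => wt (e g) = 0) = {0} := by
    ext g
    simp only [Finset.mem_filter, Finset.mem_univ, true_and, Finset.mem_singleton, wt_zero]
    rw [← map_zero e]; exact hi.eq_iff
  rw [this]; simp

lemma add_self' (e : G →+ (ι → ZMod 2)) (hi : Function.Injective e) (g : G) : g + g = 0 := by
  apply hi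
  rw [map_add, map_zero]
  funext i
  exact CharTwo.add_self_eq_zero (e g i)

lemma card_pow (e : G →+ (ι → ZMod 2)) (hi : Function.Injective e) :
    ∃ k, Fintype.card G = 2 ^ k := by
  let _ : Module (ZMod 2) G := AddCommGroup.zmodModule (n := 2) (fun x => by
    rw [two_nsmul]; exact add_self' e hi x)
  refine ⟨Module.finrank (ZMod 2) G, ?_⟩
  have := Module.card_eq_pow_finrank (K := ZMod 2) (V := G)
  rw [ZMod.card] at this
  exact this

lemma ar51 (N a0 a8 a16 a24 a32 : ℤ) (h0 : a0 = 1) (E0 : N = a0 + a8 + a16 + a24 + a32)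
    (E1 : 51 * a0 + 35 * a8 + 19 * a16 + 3 * a24 - 13 * a32 = 0)
    (E2 : 51^2 * a0 + 35^2 * a8 + 19^2 * a16 + 3^2 * a24 + 13^2 * a32 = 51 * N)
    (E3 : 0 ≤ 51^3 * a0 + 35^3 * a8 + 19^3 * a16 + 3^3 * a24 - 13^3 * a32) :
    12 * N = 512 * (6 + a16 + 3 * a8) ∧ 90 * N ≤ 49152 - 8192 * a16 := by
  subst h0
  constructor <;> linarith

lemma ar131 (N a0 a16 a32 a48 a64 a80 : ℤ) (h0 : a0 = 1)
    (E0 : N = a0 + a16 + a32 + a48 + a64 + a80)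
    (E1 : 131 * a0 + 99 * a16 + 67 * a32 + 35 * a48 + 3 * a64 - 29 * a80 = 0)
    (E2 : 131^2 * a0 + 99^2 * a16 + 67^2 * a32 + 35^2 * a48 + 3^2 * a64 + 29^2 * a80 = 131 * N)
    (E3 : 0 ≤ 131^3 * a0 + 99^3 * a16 + 67^3 * a32 + 35^3 * a48 + 3^3 * a64 - 29^3 * a80) :
    44 * N = 20480 + 12288 * a16 + 6144 * a32 + 2048 * a48 ∧
    -950 * N ≤ 655360 - 196608 * a32 - 131072 * a48 := by
  subst h0
  constructor <;> linarith

lemma pow_lo {k N a b : ℕ} (h : N = 2 ^ k) (h1 : 2 ^ a < N) (h2 : N < 2 ^ b) : a < k ∧ k < b := by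
  subst h
  exact ⟨(Nat.pow_lt_pow_iff_right (by norm_num)).mp h1,
    (Nat.pow_lt_pow_iff_right (by norm_num)).mp h2⟩

set_option maxHeartbeats 1000000 in
theorem L51 (e : G →+ (ι → ZMod 2)) (hi : Function.Injective e) (hf : Full e) (hs : Sep e)
    (hd : Dv 8 e) (hn : Fintype.card ι = 51) :
    Fintype.card G = 256 ∧ ∀ g, wt (e g) = 0 ∨ wt (e g) = 24 ∨ wt (e g) = 32 := by
  have hw : ∀ g, wt (e g) = 0 ∨ wt (e g) = 8 ∨ wt (e g) = 16 ∨ wt (e g) = 24 ∨ wt (e g) = 32 := by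
    intro g
    obtain ⟨p, hp⟩ := hd g
    have h1 := wt_le (e g)
    have h2 := res_card (e g)
    have h3 := len_bound (res e (e g)) (res_full _ _ hf) (res_sep _ _ hs) 4 (6 - p)
      (res_dv e g 4 hd) (by omega)
    omega
  have c0 := cnt_zero e hi
  have E0 : (Fintype.card G : ℤ) = cnt e 0 + cnt e 8 + cnt e 16 + cnt e 24 + cnt e 32 := by
    unfold cnt
    simp only [← Finset.sum_add_distrib]
    rw [Fintype.card, Finset.card_eq_sum_ones]; push_cast
    apply Finset.sum_congr rfl
    intro g _
    rcases hw g with h | h | h | h | h <;> simp [h]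
  have E1 : 51 * cnt e 0 + 35 * cnt e 8 + 19 * cnt e 16 + 3 * cnt e 24 - 13 * cnt e 32 = 0 := by
    rw [← m1 e hf]
    unfold cnt
    simp only [Finset.mul_sum, ← Finset.sum_add_distrib, ← Finset.sum_sub_distrib]
    apply Finset.sum_congr rfl
    intro g _
    rw [xs_eq, hn]
    rcases hw g with h | h | h | h | h <;> simp [h]
  have E2 : 51^2 * cnt e 0 + 35^2 * cnt e 8 + 19^2 * cnt e 16 + 3^2 * cnt e 24 + 13^2 * cnt e 32
      = 51 * (Fintype.card G : ℤ) := by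
    have := m2 e hs
    rw [hn] at this
    push_cast at this
    rw [← this]
    unfold cnt
    simp only [Finset.mul_sum, ← Finset.sum_add_distrib, ← Finset.sum_sub_distrib]
    apply Finset.sum_congr rfl
    intro g _
    rw [xs_eq, hn]
    rcases hw g with h | h | h | h | h <;> simp [h]
  have E3 : 0 ≤ 51^3 * cnt e 0 + 35^3 * cnt e 8 + 19^3 * cnt e 16 + 3^3 * cnt e 24
      - 13^3 * cnt e 32 := by
    have := m3 e
    refine this.trans (le_of_eq ?_)
    unfold cnt
    simp only [Finset.mul_sum, ← Finset.sum_add_distrib, ← Finset.sum_sub_distrib]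
    apply Finset.sum_congr rfl
    intro g _
    rw [xs_eq, hn]
    rcases hw g with h | h | h | h | h <;> simp [h]
  obtain ⟨F1, F2⟩ := ar51 _ _ _ _ _ _ c0 E0 E1 E2 E3
  clear E2 E3
  have p8 := cnt_nonneg e 8
  have p16 := cnt_nonneg e 16
  obtain ⟨k, hk⟩ := card_pow e hi
  have hN1 : 256 ≤ Fintype.card G := by
    have : (256:ℤ) ≤ Fintype.card G := by linarith
    exact_mod_cast this
  have hN2 : Fintype.card G ≤ 546 := by
    have : (Fintype.card G : ℤ) ≤ 546 := by linarith
    exact_mod_cast this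
  have hk8 : k = 8 ∨ k = 9 := by
    have := pow_lo (a := 7) (b := 10) hk (by norm_num; linarith) (by norm_num; linarith)
    omega
  rcases hk8 with rfl | rfl <;> norm_num at hk
  · have hkz : (Fintype.card G : ℤ) = 256 := by exact_mod_cast hk
    have a8 : cnt e 8 ≤ 0 := by linarith
    have a16 : cnt e 16 ≤ 0 := by linarith
    refine ⟨hk, fun g => ?_⟩
    have := cnt_eq_zero e 8 a8 g
    have := cnt_eq_zero e 16 a16 g
    have := hw g
    tauto
  · exfalso
    have hkz : (Fintype.card G : ℤ) = 512 := by exact_mod_cast hk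
    have a16 : cnt e 16 ≤ 0 := by linarith
    have a8 : cnt e 8 = 2 := by linarith
    clear hkz
    rw [cnt_card] at a8
    have a8' : (univ.filter (fun g => wt (e g) = 8)).card = 2 := by exact_mod_cast a8
    classical
    obtain ⟨a, b, hab, hS⟩ := Finset.card_eq_two.mp a8'
    have ha : wt (e a) = 8 := by
      have : a ∈ univ.filter (fun g => wt (e g) = 8) := by rw [hS]; simp
      simpa using this
    have hb : wt (e b) = 8 := by
      have : b ∈ univ.filter (fun g => wt (e g) = 8) := by rw [hS]; simp
      simpa using this
    have h0 : a + b ≠ 0 := by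
      intro h
      apply hab
      have := add_self' e hi b
      rw [← this] at h
      exact add_right_cancel h
    have hz : wt (e (a + b)) ≠ 0 := by
      rw [Ne, wt_zero, ← map_zero e]
      exact fun h => h0 (hi h)
    have h1 := res_wt e a b
    have h2 := res_wt e (a + b) b
    rw [add_assoc, add_self' e hi b, add_zero] at h2
    have h16 := cnt_eq_zero e 16 a16 (a + b)
    clear E0 E1 F1 F2 hN1 hN2 p16 p8 hk c0
    have h8 : wt (e (a + b)) = 8 := by
      rcases hw (a + b) with h | h | h | h | h <;> omega
    have : a + b ∈ univ.filter (fun g => wt (e g) = 8) := by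
      rw [Finset.mem_filter]; exact ⟨Finset.mem_univ _, h8⟩
    rw [hS] at this
    simp only [Finset.mem_insert, Finset.mem_singleton] at this
    rcases this with h | h
    · have hb0 : b = 0 := by simpa using h
      rw [hb0, map_zero, wt_zero.mpr rfl] at hb
      omega
    · have hb0 : a = 0 := by simpa using h
      rw [hb0, map_zero, wt_zero.mpr rfl] at ha
      omega

set_option maxHeartbeats 1000000 in
theorem L131 (e : G →+ (ι → ZMod 2)) (hi : Function.Injective e) (hf : Full e) (hs : Sep e)
    (hd : Dv 16 e) (hn : Fintype.card ι = 131) : False := by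
  have hw : ∀ g, wt (e g) = 0 ∨ wt (e g) = 16 ∨ wt (e g) = 32 ∨ wt (e g) = 48 ∨ wt (e g) = 64
      ∨ wt (e g) = 80 := by
    intro g
    obtain ⟨p, hp⟩ := hd g
    have h1 := wt_le (e g)
    have h2 := res_card (e g)
    have h3 := len_bound (res e (e g)) (res_full _ _ hf) (res_sep _ _ hs) 8 (8 - p)
      (res_dv e g 8 hd) (by omega)
    omega
  have c0 := cnt_zero e hi
  have E0 : (Fintype.card G : ℤ) = cnt e 0 + cnt e 16 + cnt e 32 + cnt e 48 + cnt e 64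
      + cnt e 80 := by
    unfold cnt
    simp only [← Finset.sum_add_distrib]
    rw [Fintype.card, Finset.card_eq_sum_ones]; push_cast
    apply Finset.sum_congr rfl
    intro g _
    rcases hw g with h | h | h | h | h | h <;> simp [h]
  have E1 : 131 * cnt e 0 + 99 * cnt e 16 + 67 * cnt e 32 + 35 * cnt e 48 + 3 * cnt e 64
      - 29 * cnt e 80 = 0 := by
    rw [← m1 e hf]
    unfold cnt
    simp only [Finset.mul_sum, ← Finset.sum_add_distrib, ← Finset.sum_sub_distrib]
    apply Finset.sum_congr rfl
    intro g _
    rw [xs_eq, hn]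
    rcases hw g with h | h | h | h | h | h <;> simp [h]
  have E2 : 131^2 * cnt e 0 + 99^2 * cnt e 16 + 67^2 * cnt e 32 + 35^2 * cnt e 48
      + 3^2 * cnt e 64 + 29^2 * cnt e 80 = 131 * (Fintype.card G : ℤ) := by
    have := m2 e hs
    rw [hn] at this
    push_cast at this
    rw [← this]
    unfold cnt
    simp only [Finset.mul_sum, ← Finset.sum_add_distrib]
    apply Finset.sum_congr rfl
    intro g _
    rw [xs_eq, hn]
    rcases hw g with h | h | h | h | h | h <;> simp [h]
  have E3 : 0 ≤ 131^3 * cnt e 0 + 99^3 * cnt e 16 + 67^3 * cnt e 32 + 35^3 * cnt e 48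
      + 3^3 * cnt e 64 - 29^3 * cnt e 80 := by
    have := m3 e
    refine this.trans (le_of_eq ?_)
    unfold cnt
    simp only [Finset.mul_sum, ← Finset.sum_add_distrib, ← Finset.sum_sub_distrib]
    apply Finset.sum_congr rfl
    intro g _
    rw [xs_eq, hn]
    rcases hw g with h | h | h | h | h | h <;> simp [h]
  obtain ⟨F1, F2⟩ := ar131 _ _ _ _ _ _ _ c0 E0 E1 E2 E3
  clear E2 E3
  have p16 := cnt_nonneg e 16
  have p32 := cnt_nonneg e 32
  have p48 := cnt_nonneg e 48
  have p64 := cnt_nonneg e 64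
  -- structure at words of weight 80
  have st : ∀ a, wt (e a) = 80 → Fintype.card G ≤
        256 * (univ.filter (fun g => wt (res e (e a) g) = 0)).card ∧
      ∀ g, wt (res e (e a) g) = 0 ∨ wt (res e (e a) g) = 24 ∨ wt (res e (e a) g) = 32 := by
    intro a ha
    classical
    let _ : Fintype (res e (e a)).range := Fintype.ofFinite _
    have hc := res_card (e a)
    have hdv := res_dv e a 8 hd
    have hful := res_full e (e a) hf
    have hsp := res_sep e (e a) hs
    have := L51 (res e (e a)).range.subtype Subtype.val_injective
      (fun i => by
        obtain ⟨g, hg⟩ := hful i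
        exact ⟨⟨_, g, rfl⟩, hg⟩)
      (fun i j hij => by
        obtain ⟨g, hg⟩ := hsp i j hij
        exact ⟨⟨_, g, rfl⟩, hg⟩)
      (by rintro ⟨_, g, rfl⟩; exact hdv g)
      (by omega)
    refine ⟨?_, fun g => this.2 ⟨_, g, rfl⟩⟩
    have h2 := Finset.card_eq_sum_card_fiberwise (s := (univ : Finset G))
      (f := fun g => (⟨res e (e a) g, g, rfl⟩ : (res e (e a)).range)) (t := univ)
      (fun _ _ => Finset.mem_coe.mpr (Finset.mem_univ _))
    rw [Finset.card_univ] at h2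
    rw [h2, ← this.1, ← smul_eq_mul, ← Finset.card_univ]
    apply Finset.sum_le_card_nsmul
    rintro ⟨_, g0, rfl⟩ _
    apply Finset.card_le_card_of_injOn (fun g => g - g0)
    · intro g hg
      simp only [Finset.coe_filter, Finset.mem_univ, true_and, Set.mem_ofPred_eq] at hg ⊢
      have hg2 : res e (e a) g = res e (e a) g0 := congrArg Subtype.val hg
      rw [wt_zero, map_sub, hg2, sub_self]
    · intro x _ y _ hxy
      exact sub_left_injective hxy
  have hex : ∃ a, wt (e a) = 80 := by
    by_contra h
    push Not at h
    have : cnt e 80 = 0 := by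
      unfold cnt; apply Finset.sum_eq_zero; intro g _; simp [h g]
    linarith
  -- no words of weight 16 or 32
  have hno : ∀ g, wt (e g) ≠ 16 ∧ wt (e g) ≠ 32 := by
    clear E0 E1 F1 F2 p16 p32 p48 p64 c0
    intro g
    by_contra hg
    have hg' : wt (e g) = 16 ∨ wt (e g) = 32 := by tauto
    have hsub : ∀ a, wt (e a) = 80 → ∀ i, e g i ≠ 0 → e a i ≠ 0 := by
      intro a ha i hgi hai
      have h1 := res_wt e a g
      have h2 := (st a ha).2 g
      have h3 := hw (a + g)
      have h4 : wt (res e (e a) g) = 0 := by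
        clear hn
        rcases h2 with h2 | h2 | h2 <;> rcases h3 with h3 | h3 | h3 | h3 | h3 | h3 <;> omega
      rw [wt_zero] at h4
      exact hgi (congrFun h4 ⟨i, hai⟩)
    have hne : ∃ i, e g i ≠ 0 := by
      by_contra h
      push Not at h
      have : e g = 0 := funext h
      rw [← wt_zero] at this
      omega
    obtain ⟨i, hgi⟩ := hne
    have hsum : ∑ a, (xs (e a) - 3) * (1 + sgn (e a i)) = -2 * Fintype.card G := by
      have : ∀ a, (xs (e a) - 3) * (1 + sgn (e a i)) =
        xs (e a) + xs (e a) * sgn (e a i) - 3 * sgn (e a i) - 3 := by intro a; ring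
      simp only [this, Finset.sum_add_distrib, Finset.sum_sub_distrib, ← Finset.mul_sum,
        m1 e hf, m1P e hs, coord e hf]
      simp
      ring
    have hpos : 0 ≤ ∑ a, (xs (e a) - 3) * (1 + sgn (e a i)) := by
      apply Finset.sum_nonneg
      intro a _
      by_cases hai : e a i = 0
      · have : wt (e a) ≠ 80 := fun h => hsub a h i hgi hai
        have h3 := hw a
        rw [xs_eq, hn, hai]
        simp only [sgn, if_true]
        push_cast
        omega
      · simp [sgn, hai]
    have := pos G
    linarith
  have z16 : cnt e 16 = 0 := by
    unfold cnt; apply Finset.sum_eq_zero; intro g _; simp [(hno g).1]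
  have z32 : cnt e 32 = 0 := by
    unfold cnt; apply Finset.sum_eq_zero; intro g _; simp [(hno g).2]
  obtain ⟨k, hk⟩ := card_pow e hi
  have hN1 : 466 ≤ Fintype.card G := by
    have : (466:ℤ) ≤ Fintype.card G := by linarith
    exact_mod_cast this
  have hN2 : Fintype.card G ≤ 1053 := by
    have : (Fintype.card G : ℤ) ≤ 1053 := by linarith
    exact_mod_cast this
  have hk8 : k = 9 ∨ k = 10 := by
    have := pow_lo (a := 8) (b := 11) hk (by norm_num; linarith) (by norm_num; linarith)
    omega
  rcases hk8 with rfl | rfl <;> norm_num at hk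
  · have hkz : (Fintype.card G : ℤ) = 512 := by exact_mod_cast hk
    have a48 : cnt e 48 = 1 := by linarith
    have a80 : cnt e 80 = 53 := by linarith
    have : ∃ b, wt (e b) = 48 := by
      by_contra h
      push Not at h
      have : cnt e 48 = 0 := by
        unfold cnt; apply Finset.sum_eq_zero; intro g _; simp [h g]
      linarith
    obtain ⟨b, hb⟩ := this
    clear E0 E1 F1 F2 hN1 hN2 z16 z32 p16 p32 p48 p64 hk c0
    have hst : ∀ a, wt (e a) = 80 → wt (e (a + b)) = 80 := by
      intro a ha
      have h1 := res_wt e a b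
      have h2 := (st a ha).2 b
      have h3 := hw (a + b)
      have h4 := hno (a + b)
      clear a48 a80 hn
      rcases h2 with h2 | h2 | h2 <;> rcases h3 with h3 | h3 | h3 | h3 | h3 | h3 <;> omega
    have h53 : ∑ g ∈ univ.filter (fun g => wt (e g) = 80), (1 : ZMod 2) = 0 := by
      apply Finset.sum_involution (fun g _ => g + b)
      · intro a _; decide
      · intro a _ _ h
        have hb0 : b = 0 := by simpa using h
        rw [hb0, map_zero, wt_zero.mpr rfl] at hb
        omega
      · intro a ha
        simp only [Finset.mem_filter, Finset.mem_univ, true_and] at ha ⊢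
        exact hst a ha
      · intro a _
        rw [add_assoc, add_self' e hi, add_zero]
    rw [cnt_card] at a80
    have a80' : (univ.filter (fun g => wt (e g) = 80)).card = 53 := by exact_mod_cast a80
    rw [Finset.sum_const, a80'] at h53
    revert h53; decide
  · obtain ⟨a, ha⟩ := hex
    have h1 := (st a ha).1
    have h2 : 2 < (univ.filter (fun g => wt (res e (e a) g) = 0)).card := by
      rw [hk] at h1
      by_contra h
      push Not at h
      linarith
    clear E0 E1 F1 F2 hN1 hN2 z16 z32 p16 p32 p48 p64 h1 hk c0
    classical
    have h3 : ∃ g ∈ univ.filter (fun g => wt (res e (e a) g) = 0), g ∉ ({0, a} : Finset G) :=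
      Finset.exists_mem_notMem_of_card_lt_card (lt_of_le_of_lt Finset.card_le_two h2)
    obtain ⟨g, hg, hg'⟩ := h3
    simp only [Finset.mem_filter, Finset.mem_univ, true_and] at hg
    simp only [Finset.mem_insert, Finset.mem_singleton, not_or] at hg'
    have h4 := res_wt e a g
    have z1 : wt (e g) ≠ 0 := by
      rw [Ne, wt_zero, ← map_zero e]
      exact fun h => hg'.1 (hi h)
    have z2 : wt (e (a + g)) ≠ 0 := by
      rw [Ne, wt_zero, ← map_zero e]
      intro h
      have := hi h
      rw [← add_self' e hi a] at this
      exact hg'.2 (add_left_cancel this)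
    have big : ∀ x, wt (e x) ≠ 0 → 48 ≤ wt (e x) := by
      clear h4 ha z1 z2 hg hn
      intro x hx
      have h1 := hw x
      have h2 := hno x
      omega
    have b1 := big g z1
    have b2 := big (a + g) z2
    omega

lemma neg_word (e : G →+ (ι → ZMod 2)) (hf : Full e) : ∃ g, xs (e g) ≤ 0 := by
  by_contra h
  push Not at h
  have h1 : 0 < ∑ g, xs (e g) := Finset.sum_pos (fun g _ => h g) ⟨0, Finset.mem_univ _⟩
  rw [m1 e hf] at h1
  exact lt_irrefl _ h1

lemma L7 (e : G →+ (ι → ZMod 2)) (hf : Full e) (hd : Dv 8 e) (hn : Fintype.card ι = 7) : False := by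
  obtain ⟨g, hg⟩ := neg_word e hf
  have h1 := wt_le (e g)
  obtain ⟨p, hp⟩ := hd g
  rw [xs_eq] at hg
  omega

lemma L39 (e : G →+ (ι → ZMod 2)) (hf : Full e) (hd : Dv 16 e) (hn : Fintype.card ι = 39) :
    False := by
  obtain ⟨g, hg⟩ := neg_word e hf
  have h1 := wt_le (e g)
  obtain ⟨p, hp⟩ := hd g
  rw [xs_eq] at hg
  have h2 := res_card (e g)
  exact L7 (res e (e g)) (res_full _ _ hf) (res_dv e g 8 hd) (by omega)

theorem L135 (e : G →+ (ι → ZMod 2)) (hf : Full e) (hd : Dv 32 e) (hn : Fintype.card ι = 135) :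
    False := by
  obtain ⟨g, hg⟩ := neg_word e hf
  have h1 := wt_le (e g)
  obtain ⟨p, hp⟩ := hd g
  rw [xs_eq] at hg
  have h2 := res_card (e g)
  have h3 : p = 3 ∨ p = 4 := by omega
  rcases h3 with rfl | rfl
  · exact L39 (res e (e g)) (res_full _ _ hf) (res_dv e g 16 hd) (by omega)
  · have hd' := res_dv e g 16 hd
    exact L7 (res e (e g)) (res_full _ _ hf) (fun g => (by norm_num : 8 ∣ 16).trans (hd' g))
      (by omega)

end code
end CDC
set_option linter.unusedSectionVars false
namespace CDC
open Finset

lemma half {M : Type*} [AddCommGroup M] [Module (ZMod 2) M] [Fintype M] (φ : M →ₗ[ZMod 2] ZMod 2) :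
    wt (fun x => φ x) = 0 ∨ 2 * wt (fun x => φ x) = Fintype.card M := by
  by_cases h : ∃ x, φ x ≠ 0
  · right
    have h1 := char_zero φ.toAddMonoidHom h
    have h2 := xs_eq (fun x => φ x)
    unfold xs at h2
    have h3 : ∑ i, sgn (φ i) = 0 := h1
    rw [h3] at h2
    omega
  · left
    push Not at h
    rw [wt_zero]; funext x; exact h x

section geo
open scoped Classical
variable {V : Type*} [AddCommGroup V] [Module (ZMod 2) V] [Fintype V]

noncomputable def deg (T : Finset (Submodule (ZMod 2) V)) (v : V) : ℕ := (T.filter (v ∈ ·)).card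

noncomputable def mult (T : Finset (Submodule (ZMod 2) V)) (D : ℕ) (v : V) : ℕ :=
  if v = 0 then 0 else D - deg T v

abbrev Idx (T : Finset (Submodule (ZMod 2) V)) (D : ℕ) : Type _ := Σ v : V, Fin (mult T D v)

noncomputable def code (T : Finset (Submodule (ZMod 2) V)) (D : ℕ) :
    Module.Dual (ZMod 2) V →+ (Idx T D → ZMod 2) where
  toFun φ := fun i => φ i.1
  map_zero' := by funext i; simp
  map_add' := by intro a b; funext i; simp

lemma sum_deg (T : Finset (Submodule (ZMod 2) V)) (f : V → ℤ) :
    ∑ v, (deg T v : ℤ) * f v = ∑ U ∈ T, ∑ u : U, f u := by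
  have : ∀ v, (deg T v : ℤ) * f v = ∑ U ∈ T, if v ∈ U then f v else 0 := by
    intro v
    rw [deg, Finset.card_filter]
    push_cast
    rw [Finset.sum_mul]
    apply Finset.sum_congr rfl
    intro U _
    split_ifs <;> simp
  simp only [this]
  rw [Finset.sum_comm]
  apply Finset.sum_congr rfl
  intro U _
  rw [← Finset.sum_filter]
  exact Finset.sum_subtype _ (fun x => by simp) f

lemma card_idx (T : Finset (Submodule (ZMod 2) V)) (D d : ℕ)
    (hd : ∀ U ∈ T, Module.finrank (ZMod 2) U = d) (hD : ∀ v, v ≠ 0 → deg T v ≤ D) :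
    (Fintype.card (Idx T D) : ℤ) = D * (Fintype.card V - 1) - T.card * (2 ^ d - 1) := by
  have h1 : (Fintype.card (Idx T D) : ℤ) = ∑ v, (mult T D v : ℤ) := by
    rw [Fintype.card_sigma]; simp
  have h2 : ∀ v, (mult T D v : ℤ) = D - deg T v * 1 - if v = 0 then ((D:ℤ) - T.card) else 0 := by
    intro v
    by_cases h : v = 0
    · subst h
      simp [mult, deg]
    · have := hD v h
      simp [mult, h]
      omega
  rw [h1]
  simp only [h2, Finset.sum_sub_distrib, sum_deg]
  have h3 : ∑ U ∈ T, ∑ u : U, (1:ℤ) = T.card * 2 ^ d := by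
    have hh : (T.card : ℤ) * 2 ^ d = ∑ U ∈ T, (2:ℤ) ^ d := by simp
    rw [hh]
    apply Finset.sum_congr rfl
    intro U hU
    have := Module.card_eq_pow_finrank (K := ZMod 2) (V := U)
    rw [hd U hU, ZMod.card] at this
    simp [this]
  rw [h3]
  simp
  ring

lemma code_dv (T : Finset (Submodule (ZMod 2) V)) (D d n : ℕ)
    (hd : ∀ U ∈ T, Module.finrank (ZMod 2) U = d + 1) (hD : ∀ v, v ≠ 0 → deg T v ≤ D)
    (hV : Module.finrank (ZMod 2) V = n + 1) (hdn : d ≤ n) : Dv (2 ^ d) (code T D) := by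
  intro φ
  have e1 : (wt (code T D φ) : ℤ) = ∑ v, (mult T D v : ℤ) * (if φ v = 0 then (0:ℤ) else 1) := by
    rw [wt_eq_sum, Fintype.sum_sigma]
    apply Finset.sum_congr rfl
    intro v _
    have : ∀ y : Fin (mult T D v), code T D φ ⟨v, y⟩ = φ v := fun _ => rfl
    simp only [this, Finset.sum_const, Finset.card_univ, Fintype.card_fin, nsmul_eq_mul]
  have e2 : ∀ v, (mult T D v : ℤ) * (if φ v = 0 then (0:ℤ) else 1)
      = D * (if φ v = 0 then (0:ℤ) else 1) - deg T v * (if φ v = 0 then (0:ℤ) else 1) := by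
    intro v
    by_cases h : v = 0
    · subst h; simp
    · have := hD v h
      simp only [mult, h, if_false]
      push_cast [this]
      ring
  have e3 : (wt (code T D φ) : ℤ) = D * wt (fun v => φ v)
      - ∑ U ∈ T, (wt (fun u : U => φ u) : ℤ) := by
    rw [e1]
    simp only [e2, Finset.sum_sub_distrib, sum_deg, wt_eq_sum, Finset.mul_sum]
  have hVc := Module.card_eq_pow_finrank (K := ZMod 2) (V := V)
  rw [hV, ZMod.card, pow_succ] at hVc
  have : ((2 ^ d : ℕ) : ℤ) ∣ (wt (code T D φ) : ℤ) := by
    rw [e3]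
    apply dvd_sub
    · apply Dvd.dvd.mul_left
      apply Int.natCast_dvd_natCast.mpr
      rcases half φ with h | h
      · rw [h]; exact dvd_zero _
      · have : wt (fun x => φ x) = 2 ^ n := by omega
        rw [this]; exact pow_dvd_pow 2 hdn
    · apply Finset.dvd_sum
      intro U hU
      apply Int.natCast_dvd_natCast.mpr
      have hUc := Module.card_eq_pow_finrank (K := ZMod 2) (V := U)
      rw [hd U hU, ZMod.card, pow_succ] at hUc
      rcases half (φ.domRestrict U) with h | h
      · have h' : wt (fun u : U => φ u) = 0 := h
        rw [h']; exact dvd_zero _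
      · have h' : 2 * wt (fun u : U => φ u) = Fintype.card U := h
        have : wt (fun x : U => φ x) = 2 ^ d := by omega
        rw [this]
  exact Int.natCast_dvd_natCast.mp this

lemma exists_dual {v : V} (h : v ≠ 0) : ∃ φ : Module.Dual (ZMod 2) V, φ v ≠ 0 := by
  by_contra hc
  push Not at hc
  exact h ((Module.forall_dual_apply_eq_zero_iff (ZMod 2) v).mp hc)

lemma code_full (T : Finset (Submodule (ZMod 2) V)) (D : ℕ) : Full (code T D) := by
  rintro ⟨v, a⟩
  have : v ≠ 0 := by
    rintro rfl
    have := a.2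
    simp [mult] at this
  exact exists_dual this

lemma code_sep (T : Finset (Submodule (ZMod 2) V)) : Sep (code T 1) := by
  rintro ⟨v, a⟩ ⟨w, b⟩ hne
  by_cases h : v = w
  · subst h
    exfalso
    apply hne
    have : mult T 1 v ≤ 1 := by unfold mult; split_ifs <;> omega
    have hab : a = b := by ext; omega
    rw [hab]
  · obtain ⟨φ, hφ⟩ := exists_dual (sub_ne_zero.mpr h)
    refine ⟨φ, fun h' => hφ ?_⟩
    rw [map_sub]
    exact sub_eq_zero.mpr h'

theorem spread (T : Finset (Submodule (ZMod 2) V)) (hV : Module.finrank (ZMod 2) V = 18)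
    (hd : ∀ U ∈ T, Module.finrank (ZMod 2) U = 5)
    (hT : ∀ U ∈ T, ∀ W ∈ T, U ≠ W → U ⊓ W = ⊥) : T.card ≤ 8451 := by
  by_contra hc
  obtain ⟨T', hsub, hcard⟩ := Finset.exists_subset_card_eq (show 8452 ≤ T.card by omega)
  have hdeg : ∀ v, v ≠ 0 → deg T' v ≤ 1 := by
    intro v hv
    unfold deg
    rw [Finset.card_le_one]
    intro U hU W hW
    rw [Finset.mem_filter] at hU hW
    by_contra hne
    have h := hT U (hsub hU.1) W (hsub hW.1) hne
    have : v ∈ U ⊓ W := ⟨hU.2, hW.2⟩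
    rw [h] at this
    exact hv ((Submodule.mem_bot _).mp this)
  have hd' : ∀ U ∈ T', Module.finrank (ZMod 2) U = 5 := fun U hU => hd U (hsub hU)
  have hc1 := card_idx T' 1 5 hd' hdeg
  have hdv := code_dv T' 1 4 17 hd' hdeg hV (by norm_num)
  have hful := code_full T' 1
  have hsp := code_sep T'
  have hVc := Module.card_eq_pow_finrank (K := ZMod 2) (V := V)
  rw [hV, ZMod.card] at hVc
  rw [hVc, hcard] at hc1
  norm_num at hc1
  let _ : Fintype (code T' 1).range := Fintype.ofFinite _
  exact L131 (code T' 1).range.subtype Subtype.val_injective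
      (fun i => by
        obtain ⟨g, hg⟩ := hful i
        exact ⟨⟨_, g, rfl⟩, hg⟩)
      (fun i j hij => by
        obtain ⟨g, hg⟩ := hsp i j hij
        exact ⟨⟨_, g, rfl⟩, hg⟩)
      (by rintro ⟨_, g, rfl⟩; exact hdv g)
      (by rw [Fintype.card_sigma]; simpa using (by exact_mod_cast hc1))

theorem deg_bound (T : Finset (Submodule (ZMod 2) V)) (hV : Module.finrank (ZMod 2) V = 19)
    (hd : ∀ U ∈ T, Module.finrank (ZMod 2) U = 6)
    (hT : ∀ U ∈ T, ∀ W ∈ T, U ≠ W → Module.finrank (ZMod 2) ↥(U ⊓ W) ≤ 1)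
    (v : V) (hv : v ≠ 0) : deg T v ≤ 8451 := by
  set P : Submodule (ZMod 2) V := Submodule.span (ZMod 2) {v} with hP
  have hPf : Module.finrank (ZMod 2) P = 1 := finrank_span_singleton hv
  let _ : Fintype (V ⧸ P) := Fintype.ofFinite _
  have hle : ∀ U : Submodule (ZMod 2) V, v ∈ U → P ≤ U := by
    intro U hU
    rw [hP, Submodule.span_singleton_le_iff_mem]; exact hU
  have hfr : ∀ U ∈ T, v ∈ U → Module.finrank (ZMod 2) (U.map P.mkQ) = 5 := by
    intro U hU hvU
    have h1 := LinearMap.finrank_range_add_finrank_ker (P.mkQ.domRestrict U)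
    rw [LinearMap.range_domRestrict, LinearMap.ker_domRestrict, Submodule.ker_mkQ, hd U hU] at h1
    have h2 := (Submodule.submoduleOfEquivOfLe (hle U hvU)).finrank_eq
    unfold Submodule.submoduleOf at h2
    omega
  have hdis : ∀ U ∈ T, v ∈ U → ∀ W ∈ T, v ∈ W → U ≠ W → U.map P.mkQ ⊓ W.map P.mkQ = ⊥ := by
    intro U hU hvU W hW hvW hne
    have hPU : P = U ⊓ W := by
      apply Submodule.eq_of_le_of_finrank_le (le_inf (hle U hvU) (hle W hvW))
      rw [hPf]; exact hT U hU W hW hne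
    rw [eq_bot_iff]
    rintro x ⟨⟨u, hu, rfl⟩, ⟨w, hw, hwu⟩⟩
    have h1 : w - u ∈ P := by
      rw [← Submodule.ker_mkQ P, LinearMap.mem_ker, map_sub, hwu, sub_self]
    have h2 : u ∈ W := by
      have := W.sub_mem hw (hle W hvW h1)
      simpa using this
    have h3 : u ∈ P := by rw [hPU]; exact ⟨hu, h2⟩
    rw [Submodule.mem_bot, ← LinearMap.mem_ker, Submodule.ker_mkQ]
    exact h3
  have hinj : Set.InjOn (fun U : Submodule (ZMod 2) V => U.map P.mkQ) (T.filter (v ∈ ·)) := by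
    intro U hU W hW h
    simp only [Finset.coe_filter, Set.mem_ofPred_eq] at hU hW h
    by_contra hne
    have h1 := hdis U hU.1 hU.2 W hW.1 hW.2 hne
    rw [← h, inf_idem] at h1
    have h2 := hfr U hU.1 hU.2
    rw [h1, finrank_bot] at h2
    omega
  unfold deg
  rw [← Finset.card_image_of_injOn hinj]
  apply spread
  · have := Submodule.finrank_quotient_add_finrank P
    omega
  · intro U' hU'
    obtain ⟨U, hU, rfl⟩ := Finset.mem_image.mp hU'
    rw [Finset.mem_filter] at hU
    exact hfr U hU.1 hU.2
  · intro U' hU' W' hW' hne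
    obtain ⟨U, hU, rfl⟩ := Finset.mem_image.mp hU'
    obtain ⟨W, hW, rfl⟩ := Finset.mem_image.mp hW'
    rw [Finset.mem_filter] at hU hW
    exact hdis U hU.1 hU.2 W hW.1 hW.2 (fun h => hne (by rw [h]))

theorem main (T : Finset (Submodule (ZMod 2) V)) (hV : Module.finrank (ZMod 2) V = 19)
    (hd : ∀ U ∈ T, Module.finrank (ZMod 2) U = 6)
    (hT : ∀ U ∈ T, ∀ W ∈ T, U ≠ W → Module.finrank (ZMod 2) ↥(U ⊓ W) ≤ 1) :
    T.card ≤ 70329353 := by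
  by_contra hc
  obtain ⟨T', hsub, hcard⟩ := Finset.exists_subset_card_eq (show 70329354 ≤ T.card by omega)
  have hd' : ∀ U ∈ T', Module.finrank (ZMod 2) U = 6 := fun U hU => hd U (hsub hU)
  have hdeg := deg_bound T' hV hd' (fun U hU W hW => hT U (hsub hU) W (hsub hW))
  have hc1 := card_idx T' 8451 6 hd' hdeg
  have hdv := code_dv T' 8451 5 18 hd' hdeg hV (by norm_num)
  have hVc := Module.card_eq_pow_finrank (K := ZMod 2) (V := V)
  rw [hV, ZMod.card] at hVc
  rw [hVc, hcard] at hc1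
  norm_num at hc1
  have : Finite (Module.Dual (ZMod 2) V) := DFunLike.finite _
  let _ : Fintype (Module.Dual (ZMod 2) V) := Fintype.ofFinite _
  exact L135 (code T' 8451) (code_full T' 8451) hdv
      (by rw [Fintype.card_sigma]; simpa using (by exact_mod_cast hc1))

end geo
end CDC

/-- `A₂(19, 10; 6) ≤ 70329353`. -/
theorem cdc_bound_19_10_6
    (𝒮 : Finset (Submodule (ZMod 2) (Fin 19 → ZMod 2)))
    (hdim : ∀ U ∈ 𝒮, Module.finrank (ZMod 2) U = 6)
    (hdist : ∀ U ∈ 𝒮, ∀ W ∈ 𝒮, U ≠ W →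
      10 ≤ Module.finrank (ZMod 2) U + Module.finrank (ZMod 2) W
            - 2 * Module.finrank (ZMod 2) ↥(U ⊓ W)) :
    𝒮.card ≤ 70329353 := by
  apply CDC.main 𝒮 (by simp) hdim
  intro U hU W hW hne
  have h := hdist U hU W hW hne
  rw [hdim U hU, hdim W hW] at h
  omega
end

section
/- Let C be a projective 8-divisible binary linear code of effective length 51. Then the number of weight-3 vectors in the dual code C^⊥ equals 17. -/
set_option maxRecDepth 20000
/-- Hamming weight of a binary vector. -/
def hwt {n : ℕ} (c : Fin n → ZMod 2) : ℕ :=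
  (Finset.univ.filter fun i => c i ≠ 0).card

open Finset in
theorem aux_char (C : Submodule (ZMod 2) (Fin 51 → ZMod 2)) [Fintype C]
    (χ : ZMod 2 → ℤ) (h0 : χ 0 = 1) (h1 : χ 1 = -1)
    (f : C → ZMod 2) (hf : ∀ a b, f (a + b) = f a + f b) (c0 : C) (hc : f c0 ≠ 0) :
    ∑ c : C, χ (f c) = 0 := by
  have hc1 : f c0 = 1 := by
    generalize f c0 = a at hc
    revert hc; revert a; decide
  have hneg : ∀ a : ZMod 2, χ (a + 1) = - χ a := by
    intro a
    have : a = 0 ∨ a = 1 := by revert a; decide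
    have h2 : (1 : ZMod 2) + 1 = 0 := by decide
    rcases this with rfl | rfl
    · rw [zero_add, h0, h1]
    · rw [h2, h0, h1]; norm_num
  have h := Equiv.sum_comp (Equiv.addRight c0) (fun c => χ (f c))
  simp only [Equiv.coe_addRight, hf, hc1, hneg, Finset.sum_neg_distrib] at h
  linarith

def chi2 (a : ZMod 2) : ℤ := if a = 0 then 1 else -1

theorem chi2_add : ∀ a b : ZMod 2, chi2 (a + b) = chi2 a * chi2 b := by decide

def SZ (Z : Finset (Fin 51)) (c : Fin 51 → ZMod 2) : ℤ := ∑ i ∈ Z, chi2 (c i)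

theorem SZ_eq (Z : Finset (Fin 51)) (c : Fin 51 → ZMod 2) :
    SZ Z c = Z.card - 2 * ((Z.filter fun i => c i ≠ 0).card : ℤ) := by
  have : ∀ a : ZMod 2, chi2 a = 1 - 2 * (if a ≠ 0 then 1 else 0) := by decide
  simp only [SZ, this, Finset.sum_sub_distrib, ← Finset.mul_sum, Finset.sum_boole]
  simp

theorem SZ_sum (C : Submodule (ZMod 2) (Fin 51 → ZMod 2)) [Fintype C]
    (heff : ∀ i : Fin 51, ∃ c ∈ C, c i ≠ 0) (Z : Finset (Fin 51)) :
    ∑ c : C, SZ Z c = 0 := by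
  simp only [SZ]
  rw [Finset.sum_comm]
  apply Finset.sum_eq_zero
  intro i _
  obtain ⟨c, hc, h⟩ := heff i
  exact aux_char C chi2 (by decide) (by decide) (fun c => c.1 i) (by simp) ⟨c, hc⟩ h

theorem SZ_sq_sum (C : Submodule (ZMod 2) (Fin 51 → ZMod 2)) [Fintype C]
    (hproj : ∀ i j : Fin 51, i ≠ j → ∃ c ∈ C, c i ≠ c j) (Z : Finset (Fin 51)) :
    ∑ c : C, SZ Z c ^ 2 = Fintype.card C * Z.card := by
  simp only [SZ, pow_two, Finset.sum_mul_sum, ← chi2_add]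
  rw [Finset.sum_comm]
  have : ∀ i ∈ Z, ∑ c : C, ∑ j ∈ Z, chi2 (c.1 i + c.1 j) = Fintype.card C := by
    intro i hi
    rw [Finset.sum_comm, Finset.sum_eq_single i]
    · have : ∀ a : ZMod 2, chi2 (a + a) = 1 := by decide
      simp [this]
    · intro j _ hj
      obtain ⟨c, hc, h⟩ := hproj i j hj.symm
      refine aux_char C chi2 (by decide) (by decide) (fun c => c.1 i + c.1 j) ?_ ⟨c, hc⟩ ?_
      · intro a b; simp; ring
      · simp only
        generalize c i = a at h
        generalize c j = b at h
        revert a b; decide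
    · intro h; exact absurd hi h
  rw [Finset.sum_congr rfl this]
  simp [mul_comm]

open Classical in
noncomputable def trip (C : Submodule (ZMod 2) (Fin 51 → ZMod 2)) :
    Finset (Fin 51 × Fin 51 × Fin 51) :=
  Finset.univ.filter fun t => ∀ c ∈ C, c t.1 + c t.2.1 + c t.2.2 = 0

theorem S_cube_sum (C : Submodule (ZMod 2) (Fin 51 → ZMod 2)) [Fintype C] :
    ∑ c : C, SZ Finset.univ c ^ 3 = Fintype.card C * (trip C).card := by
  have h1 : ∀ c : C, SZ Finset.univ c ^ 3 =
      ∑ t : Fin 51 × Fin 51 × Fin 51, chi2 (c.1 t.1 + c.1 t.2.1 + c.1 t.2.2) := by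
    intro c
    simp only [SZ, pow_succ, pow_zero, one_mul, Fintype.sum_prod_type, chi2_add]
    simp only [← Finset.mul_sum, ← Finset.sum_mul]
  classical
  simp only [h1]
  rw [Finset.sum_comm]
  have h2 : ∀ t : Fin 51 × Fin 51 × Fin 51,
      ∑ c : C, chi2 (c.1 t.1 + c.1 t.2.1 + c.1 t.2.2) =
      if (∀ c ∈ C, c t.1 + c t.2.1 + c t.2.2 = 0) then (Fintype.card C : ℤ) else 0 := by
    intro t
    split_ifs with h
    · have : ∀ c : C, chi2 (c.1 t.1 + c.1 t.2.1 + c.1 t.2.2) = 1 := by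
        intro c; rw [h c.1 c.2]; decide
      simp [this]
    · push Not at h
      obtain ⟨c, hc, h⟩ := h
      refine aux_char C chi2 (by decide) (by decide)
        (fun c => c.1 t.1 + c.1 t.2.1 + c.1 t.2.2) ?_ ⟨c, hc⟩ h
      intro a b; simp; ring
  simp only [h2]
  rw [← Finset.sum_filter, Finset.sum_const, trip, nsmul_eq_mul, mul_comm]

open Classical in
noncomputable def lin3 (C : Submodule (ZMod 2) (Fin 51 → ZMod 2)) :
    Finset (Finset (Fin 51)) :=
  Finset.univ.filter fun s => s.card = 3 ∧ ∀ c ∈ C, ∑ i ∈ s, c i = 0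

theorem trip_card (C : Submodule (ZMod 2) (Fin 51 → ZMod 2))
    (heff : ∀ i : Fin 51, ∃ c ∈ C, c i ≠ 0) :
    (trip C).card = 6 * (lin3 C).card := by
  classical
  have hz : ∀ a : ZMod 2, a + a = 0 := by decide
  have hd : ∀ i j k : Fin 51, (i, j, k) ∈ trip C → i ≠ j ∧ i ≠ k ∧ j ≠ k := by
    intro i j k h
    simp only [trip, Finset.mem_filter, Finset.mem_univ, true_and] at h
    refine ⟨?_, ?_, ?_⟩
    · rintro rfl
      obtain ⟨c, hc, hh⟩ := heff k
      have := h c hc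
      rw [hz, zero_add] at this
      exact hh this
    · rintro rfl
      obtain ⟨c, hc, hh⟩ := heff j
      have := h c hc
      rw [add_right_comm, hz, zero_add] at this
      exact hh this
    · rintro rfl
      obtain ⟨c, hc, hh⟩ := heff i
      have := h c hc
      rw [add_assoc, hz, add_zero] at this
      exact hh this
  have hmap : ∀ t ∈ trip C, ({t.1, t.2.1, t.2.2} : Finset (Fin 51)) ∈ lin3 C := by
    rintro ⟨i, j, k⟩ h
    obtain ⟨h1, h2, h3⟩ := hd i j k h
    simp only [trip, lin3, Finset.mem_filter, Finset.mem_univ, true_and] at h ⊢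
    refine ⟨Finset.card_eq_three.2 ⟨i, j, k, h1, h2, h3, rfl⟩, ?_⟩
    intro c hc
    rw [Finset.sum_insert (by simp [h1, h2]), Finset.sum_insert (by simp [h3]),
      Finset.sum_singleton, ← add_assoc]
    exact h c hc
  rw [Finset.card_eq_sum_card_fiberwise hmap]
  rw [Finset.sum_const_nat (m := 6), mul_comm]
  intro s hs
  simp only [lin3, Finset.mem_filter, Finset.mem_univ, true_and] at hs
  obtain ⟨h3, hs⟩ := hs
  obtain ⟨x, y, z, hxy, hxz, hyz, rfl⟩ := Finset.card_eq_three.1 h3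
  have hsum : ∀ c ∈ C, c x + c y + c z = 0 := by
    intro c hc
    have := hs c hc
    rwa [Finset.sum_insert (by simp [hxy, hxz]), Finset.sum_insert (by simp [hyz]),
      Finset.sum_singleton, ← add_assoc] at this
  have : (trip C).filter (fun t => ({t.1, t.2.1, t.2.2} : Finset (Fin 51)) = {x, y, z}) =
      {(x, y, z), (x, z, y), (y, x, z), (y, z, x), (z, x, y), (z, y, x)} := by
    ext ⟨i, j, k⟩
    simp only [Finset.mem_filter, Finset.mem_insert, Finset.mem_singleton, Prod.mk.injEq]
    constructor
    · rintro ⟨h, he⟩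
      obtain ⟨h1, h2, h3⟩ := hd i j k h
      have hi : i ∈ ({x, y, z} : Finset (Fin 51)) := by rw [← he]; simp
      have hj : j ∈ ({x, y, z} : Finset (Fin 51)) := by rw [← he]; simp
      have hk : k ∈ ({x, y, z} : Finset (Fin 51)) := by rw [← he]; simp
      simp only [Finset.mem_insert, Finset.mem_singleton] at hi hj hk
      grind
    · intro h
      constructor
      · simp only [trip, Finset.mem_filter, Finset.mem_univ, true_and]
        intro c hc
        have := hsum c hc
        rcases h with h | h | h | h | h | h <;> obtain ⟨rfl, rfl, rfl⟩ := h <;>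
          rw [← this] <;> ring
      · ext a
        simp only [Finset.mem_insert, Finset.mem_singleton]
        grind
  rw [this]
  simp [Finset.card_insert_of_notMem, hxy, hxz, hyz, hxy.symm, hxz.symm, hyz.symm]

theorem ncard_eq (C : Submodule (ZMod 2) (Fin 51 → ZMod 2)) :
    Set.ncard {x : Fin 51 → ZMod 2 |
      (∀ c ∈ C, ∑ j, x j * c j = 0) ∧ hwt x = 3} = (lin3 C).card := by
  classical
  have hsum : ∀ x c : Fin 51 → ZMod 2,
      ∑ j, x j * c j = ∑ j ∈ Finset.univ.filter (fun i => x i ≠ 0), c j := by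
    intro x c
    rw [Finset.sum_filter]
    apply Finset.sum_congr rfl
    intro j _
    generalize x j = a
    generalize c j = b
    revert a b; decide
  rw [← Set.ncard_coe_finset]
  refine Set.ncard_congr (fun x _ => Finset.univ.filter (fun i => x i ≠ 0)) ?_ ?_ ?_
  · rintro x ⟨h1, h2⟩
    simp only [lin3, Finset.coe_filter, Finset.mem_univ, true_and, Set.mem_ofPred_eq]
    exact ⟨h2, fun c hc => (hsum x c).symm.trans (h1 c hc)⟩
  · intro x y _ _ h
    funext i
    have := congrArg (fun s => i ∈ s) h
    simp only [Finset.mem_filter, Finset.mem_univ, true_and, eq_iff_iff] at this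
    generalize x i = a at this
    generalize y i = b at this
    revert a b; decide
  · intro s hs
    simp only [lin3, Finset.coe_filter, Finset.mem_univ, true_and, Set.mem_ofPred_eq] at hs
    have he : Finset.univ.filter (fun i => (if i ∈ s then (1 : ZMod 2) else 0) ≠ 0) = s := by
      ext i; simp
    refine ⟨fun i => if i ∈ s then 1 else 0, ⟨?_, ?_⟩, he⟩
    · intro c hc
      rw [hsum, he]; exact hs.2 c hc
    · rw [hwt, he]; exact hs.1

theorem wtZ_eq (c d : Fin 51 → ZMod 2) :
    hwt d + hwt (c + d) = 2 * ((Finset.univ.filter fun i => c i = 0).filter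
      fun i => d i ≠ 0).card + hwt c := by
  simp only [hwt, Finset.filter_filter, Finset.card_filter, Finset.mul_sum,
    ← Finset.sum_add_distrib]
  apply Finset.sum_congr rfl
  intro i _
  have : ∀ a : ZMod 2, a = 0 ∨ a = 1 := by decide
  have h2 : (1 : ZMod 2) + 1 = 0 := by decide
  rcases this (c i) with h | h <;> rcases this (d i) with h' | h' <;> simp [h, h', h2]

theorem wt_compl (c : Fin 51 → ZMod 2) :
    (Finset.univ.filter fun i => c i = 0).card + hwt c = 51 := by
  simpa [hwt] using Finset.card_filter_add_card_filter_not
    (s := (Finset.univ : Finset (Fin 51))) (fun i => c i = 0)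

theorem hwt_le (C : Submodule (ZMod 2) (Fin 51 → ZMod 2))
    (heff : ∀ i : Fin 51, ∃ c ∈ C, c i ≠ 0)
    (hproj : ∀ i j : Fin 51, i ≠ j → ∃ c ∈ C, c i ≠ c j)
    (hdiv : ∀ c ∈ C, 8 ∣ hwt c) (c : Fin 51 → ZMod 2) (hc : c ∈ C) : hwt c ≤ 32 := by
  classical
  by_contra hlt
  have hw := wt_compl c
  have h8 := hdiv c hc
  set Z := Finset.univ.filter fun i => c i = 0 with hZ
  have e1 := SZ_sum C heff Z
  have e2 := SZ_sq_sum C hproj Z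
  have hN : (0 : ℤ) < Fintype.card C := by exact_mod_cast Fintype.card_pos
  have key : ∀ d : C, 4 ∣ (Z.filter fun i => d.1 i ≠ 0).card ∧
      (Z.filter fun i => d.1 i ≠ 0).card ≤ Z.card := by
    intro d
    have h := wtZ_eq c d
    rw [← hZ] at h
    have h1 := hdiv d d.2
    have h2 := hdiv (c + d) (C.add_mem hc d.2)
    refine ⟨by omega, Finset.card_filter_le _ _⟩
  have hcase : Z.card = 11 ∨ Z.card = 3 := by omega
  rcases hcase with h | h
  · have : ∀ d : C, 0 ≤ SZ Z d ^ 2 + 2 * SZ Z d - 15 := by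
      intro d
      obtain ⟨k1, k2⟩ := key d
      rw [SZ_eq]
      have : (Z.filter fun i => d.1 i ≠ 0).card = 0 ∨ (Z.filter fun i => d.1 i ≠ 0).card = 4 ∨
        (Z.filter fun i => d.1 i ≠ 0).card = 8 := by omega
      rcases this with k | k | k <;> rw [k, h] <;> norm_num
    have := Finset.sum_nonneg (s := Finset.univ) (fun d _ => this d)
    rw [Finset.sum_sub_distrib, Finset.sum_add_distrib, ← Finset.mul_sum, e1, e2, h] at this
    simp only [Finset.sum_const, Finset.card_univ, nsmul_eq_mul] at this
    push_cast at this
    linarith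
  · have : ∀ d : C, SZ Z d = 3 := by
      intro d
      obtain ⟨k1, k2⟩ := key d
      rw [SZ_eq]
      have k : (Z.filter fun i => d.1 i ≠ 0).card = 0 := by omega
      rw [k, h]; norm_num
    simp only [this, Finset.sum_const, Finset.card_univ, nsmul_eq_mul] at e1
    linarith

theorem hwt_zero_iff (c : Fin 51 → ZMod 2) : hwt c = 0 ↔ c = 0 := by
  simp [hwt, Finset.filter_eq_empty_iff, funext_iff]

theorem hwt_add_le (c d : Fin 51 → ZMod 2) : hwt (c + d) ≤ hwt c + hwt d := by
  simp only [hwt, Finset.card_filter, ← Finset.sum_add_distrib]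
  apply Finset.sum_le_sum
  intro i _
  have : ∀ a : ZMod 2, a = 0 ∨ a = 1 := by decide
  have h2 : (1 : ZMod 2) + 1 = 0 := by decide
  rcases this (c i) with h | h <;> rcases this (d i) with h' | h' <;> simp [h, h', h2]

/-- A projective 8-divisible binary linear code of effective length 51 has exactly 17
weight-3 vectors in its dual code. -/
theorem dual_weight3_count_8_div_51 (C : Submodule (ZMod 2) (Fin 51 → ZMod 2))
    (heff : ∀ i : Fin 51, ∃ c ∈ C, c i ≠ 0)
    (hproj : ∀ i j : Fin 51, i ≠ j → ∃ c ∈ C, c i ≠ c j)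
    (hdiv : ∀ c ∈ C, 8 ∣ hwt c) :
    Set.ncard {x : Fin 51 → ZMod 2 |
      (∀ c ∈ C, ∑ j, x j * c j = 0) ∧ hwt x = 3} = 17 := by
  classical
  rw [ncard_eq]
  have hT := trip_card C heff
  have e1 := SZ_sum C heff Finset.univ
  have e2 := SZ_sq_sum C hproj Finset.univ
  have e3 := S_cube_sum C
  have hpow : Fintype.card C = 2 ^ Module.finrank (ZMod 2) C := by
    rw [Module.card_eq_pow_finrank (K := ZMod 2), ZMod.card]
  have hS : ∀ c : C, SZ Finset.univ c = 51 - 2 * (hwt c.1 : ℤ) := by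
    intro c; rw [SZ_eq]; simp [hwt]
  have hw : ∀ c : C, hwt c.1 = 0 ∨ hwt c.1 = 8 ∨ hwt c.1 = 16 ∨ hwt c.1 = 24 ∨ hwt c.1 = 32 := by
    intro c
    have h1 := hdiv c c.2
    have h2 := hwt_le C heff hproj hdiv c c.2
    omega
  set A8 := (Finset.univ.filter fun c : C => hwt c.1 = 8) with hA8
  set A16 := (Finset.univ.filter fun c : C => hwt c.1 = 16) with hA16
  have hA0 : (Finset.univ.filter fun c : C => hwt c.1 = 0) = {0} := by
    ext c; simp [hwt_zero_iff]
  have p1 : ∀ c : C, SZ Finset.univ c ^ 2 + 10 * SZ Finset.univ c - 39 =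
      3072 * (if hwt c.1 = 0 then 1 else 0) + 1536 * (if hwt c.1 = 8 then 1 else 0)
        + 512 * (if hwt c.1 = 16 then 1 else 0) := by
    intro c
    rw [hS]
    rcases hw c with h | h | h | h | h <;> rw [h] <;> norm_num
  have p2 : ∀ c : C, SZ Finset.univ c ^ 3 - 9 * SZ Finset.univ c ^ 2
      - 229 * SZ Finset.univ c + 741 =
      98304 * (if hwt c.1 = 0 then 1 else 0) + 24576 * (if hwt c.1 = 8 then 1 else 0) := by
    intro c
    rw [hS]
    rcases hw c with h | h | h | h | h <;> rw [h] <;> norm_num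
  have q1 := Finset.sum_congr (rfl : (Finset.univ : Finset C) = Finset.univ) (fun c _ => p1 c)
  have q2 := Finset.sum_congr (rfl : (Finset.univ : Finset C) = Finset.univ) (fun c _ => p2 c)
  simp only [Finset.sum_sub_distrib, Finset.sum_add_distrib, ← Finset.mul_sum, e1, e2, e3,
    Finset.sum_boole, hA0, ← hA8, ← hA16, Finset.sum_const, Finset.card_singleton,
    Finset.card_univ, Fintype.card_fin, nsmul_eq_mul] at q1 q2
  have hex : A8.card = 2 → A16.card = 0 → False := by
    intro h1 h2
    obtain ⟨u, v, huv, he⟩ := Finset.card_eq_two.1 h1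
    have hu : u ∈ A8 := by rw [he]; simp
    have hv : v ∈ A8 := by rw [he]; simp
    have hu8 : hwt u.1 = 8 := by simpa [hA8] using hu
    have hv8 : hwt v.1 = 8 := by simpa [hA8] using hv
    have hle : hwt (u + v).1 ≤ 16 := by
      have := hwt_add_le u.1 v.1
      rw [hu8, hv8] at this
      exact this
    rcases hw (u + v) with h | h | h | h | h
    · rw [hwt_zero_iff] at h
      apply huv
      ext i
      have := congrFun h i
      simp only [Submodule.coe_add, Pi.add_apply, Pi.zero_apply] at this
      have hh : ∀ a b : ZMod 2, a + b = 0 → a = b := by decide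
      exact hh _ _ this
    · have hm : u + v ∈ A8 := by simpa [hA8] using h
      rw [he] at hm
      simp only [Finset.mem_insert, Finset.mem_singleton, add_eq_left, add_eq_right] at hm
      rcases hm with hm | hm
      · rw [hm] at hv8
        have := (hwt_zero_iff (0 : C).1).2 rfl
        omega
      · rw [hm] at hu8
        have := (hwt_zero_iff (0 : C).1).2 rfl
        omega
    · have hm : u + v ∈ A16 := by simpa [hA16] using h
      rw [Finset.card_eq_zero.1 h2] at hm
      simp at hm
    · omega
    · omega
  clear_value A8 A16
  generalize A8.card = a at *
  generalize A16.card = b at *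
  rw [hT] at q2
  generalize (lin3 C).card = x at *
  generalize Module.finrank (ZMod 2) C = k at *
  generalize Fintype.card C = N at *
  push_cast at q1 q2
  have r1 : 3 * (N : ℤ) = 768 + 384 * a + 128 * b := by linarith
  have r2 : (N : ℤ) * x + 47 * N = 16384 + 4096 * a := by linarith
  have hx : 0 ≤ (N : ℤ) * x := by positivity
  have ha : a ≤ 2 := by omega
  have hN1 : 256 ≤ N := by omega
  have hN2 : N ≤ 522 := by omega
  have hk1 : 8 ≤ k := by
    by_contra h
    have : 2 ^ k ≤ 2 ^ 7 := Nat.pow_le_pow_right (by norm_num) (by omega)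
    omega
  have hk2 : k ≤ 9 := by
    by_contra h
    have : 2 ^ 10 ≤ 2 ^ k := Nat.pow_le_pow_right (by norm_num) (by omega)
    omega
  have hk : k = 8 ∨ k = 9 := by omega
  rcases hk with rfl | rfl
  · norm_num at hpow
    subst hpow
    push_cast at *
    omega
  · norm_num at hpow
    subst hpow
    push_cast at *
    have : a = 2 := by omega
    exact (hex this (by omega)).elim
end
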